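/- arXiv:1306.3315 — 2 statements merged into one kernel-verified Lean document; each statement's English description precedes it below -/
import Mathlib

section
/- Let f : ℝ → ℝ be 1-periodic, of bounded variation on [0,1], and satisfy ∫_0^1 f(x) dx = 0. Then there exists a constant C (depending only on f) such that for all positive integers m and n, | ∫_0^1 f(m x) f(n x) dx | ≤ C · gcd(m,n)² / (m n). -/
open MeasureTheory

lemma intervalIntegrable_comp_add_div {h : ℝ → ℝ}
    (hh : ∀ a b : ℝ, IntervalIntegrable h volume a b) {c : ℝ} (hc : c ≠ 0) (d a b : ℝ) :
    IntervalIntegrable (fun t => h ((t + d) / c)) volume a b := by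
  have hshift := ((hh ((a + d) / c) ((b + d) / c)).comp_mul_right (c := c⁻¹)).comp_add_right d
  have hend : ∀ x : ℝ, (x + d) / c / c⁻¹ - d = x := fun x => by field_simp; ring
  simpa only [hend, ← div_eq_mul_inv] using hshift

lemma abs_integral_zero_one_le {g : ℝ → ℝ} {C : ℝ} (hg : ∀ t ∈ Set.Icc (0 : ℝ) 1, |g t| ≤ C) :
    |∫ t in (0:ℝ)..1, g t| ≤ C := by
  have hle := intervalIntegral.norm_integral_le_of_norm_le_const (a := 0) (b := 1) (f := g)
    (C := C) fun t ht => hg t (by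
      rw [Set.uIoc_of_le zero_le_one] at ht
      exact Set.Ioc_subset_Icc_self ht)
  rwa [sub_zero, abs_one, mul_one] at hle

/-- The integral over `[0,1]` as the integral of the mean over the points `(t + k) / N`. -/
lemma mul_integral_eq_sum_integral_add_div {h : ℝ → ℝ} {N : ℕ} (hN : 0 < N)
    (hh : ∀ a b : ℝ, IntervalIntegrable h volume a b) :
    (N : ℝ) * ∫ x in (0:ℝ)..1, h x =
      ∑ k ∈ Finset.range N, ∫ t in (0:ℝ)..1, h ((t + k) / N) := by
  have hN' : (N : ℝ) ≠ 0 := by positivity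
  have hscale : ∫ x in (0:ℝ)..N, h (x / N) = N * ∫ x in (0:ℝ)..1, h x := by
    rw [intervalIntegral.integral_comp_div h hN']
    simp [hN']
  have hint : ∀ a b : ℝ, IntervalIntegrable (fun x => h (x / N)) volume a b := fun a b => by
    simpa only [add_zero] using intervalIntegrable_comp_add_div hh hN' 0 a b
  have hsum := intervalIntegral.sum_integral_adjacent_intervals (μ := volume)
    (f := fun x => h (x / N)) (a := fun k : ℕ => (k : ℝ)) (n := N) fun k _ => hint _ _
  simp only [Nat.cast_zero] at hsum
  rw [← hscale, ← hsum]
  refine Finset.sum_congr rfl fun k _ => ?_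
  rw [intervalIntegral.integral_comp_add_right (fun x => h (x / N)) (k : ℝ)]
  simp [add_comm]

/-- For coprime `a, b`, a sum over residues modulo `a * b` of products factors. -/
lemma sum_range_mul_of_coprime {a b : ℕ} (ha : 0 < a) (hb : 0 < b) (hab : Nat.Coprime a b)
    (u v : ℕ → ℝ) :
    ∑ k ∈ Finset.range (a * b), u (k % a) * v (k % b) =
      (∑ i ∈ Finset.range a, u i) * ∑ j ∈ Finset.range b, v j := by
  rw [Finset.sum_mul_sum, ← Finset.sum_product']
  have hmaps : Set.MapsTo (fun k => (k % a, k % b)) (Finset.range (a * b) : Set ℕ)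
      (Finset.range a ×ˢ Finset.range b : Finset (ℕ × ℕ)) := by
    intro k _
    simp [Nat.mod_lt _ ha, Nat.mod_lt _ hb]
  have hinj : Set.InjOn (fun k => (k % a, k % b)) (Finset.range (a * b) : Set ℕ) := by
    intro k hk l hl hkl
    simp only [Prod.mk.injEq] at hkl
    have hmod := (Nat.modEq_and_modEq_iff_modEq_mul hab).1 hkl
    exact Nat.ModEq.eq_of_lt_of_lt hmod (by simpa using hk) (by simpa using hl)
  have hsurj := Finset.surjOn_of_injOn_of_card_le _ hmaps hinj (by simp)
  exact Finset.sum_bij (fun k _ => (k % a, k % b)) (fun k hk => hmaps hk)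
    (fun k hk l hl h => hinj hk hl h)
    (fun p hp => by obtain ⟨k, hk, rfl⟩ := hsurj hp; exact ⟨k, hk, rfl⟩) (fun _ _ => rfl)

/-- The sum over shifted points differs by at most the variation as the shift changes. -/
lemma abs_sum_sub_sum_le_variation {f : ℝ → ℝ} (hbv : BoundedVariationOn f (Set.Icc (0 : ℝ) 1))
    {b : ℕ} (hb : 0 < b) {s t : ℝ} (hs : s ∈ Set.Icc (0 : ℝ) 1) (ht : t ∈ Set.Icc (0 : ℝ) 1) :
    |∑ k ∈ Finset.range b, f ((s + k) / b) - ∑ k ∈ Finset.range b, f ((t + k) / b)| ≤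
      (eVariationOn f (Set.Icc (0 : ℝ) 1)).toReal := by
  have hb' : (0 : ℝ) < b := by positivity
  have hmono : Monotone fun k : ℕ => (k : ℝ) / b := fun i j hij => by
    have : (i : ℝ) ≤ j := by exact_mod_cast hij
    dsimp only
    gcongr
  have htotal := eVariationOn.sum' f hmono (n := b)
  simp only [Nat.cast_zero, zero_div, div_self hb'.ne'] at htotal
  have hmem : ∀ k : ℕ, ∀ r ∈ Set.Icc (0 : ℝ) 1,
      (r + k) / b ∈ Set.Icc ((k : ℝ) / b) (((k + 1 : ℕ) : ℝ) / b) := by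
    intro k r hr
    push_cast
    constructor
    · gcongr
      linarith [hr.1]
    · gcongr ?_ / _
      linarith [hr.2]
  have hfin : ∀ k ∈ Finset.range b,
      eVariationOn f (Set.Icc ((k : ℝ) / b) (((k + 1 : ℕ) : ℝ) / b)) ≠ ⊤ := by
    intro k hk
    refine ne_top_of_le_ne_top hbv ?_
    rw [← htotal]
    exact Finset.single_le_sum
      (f := fun k : ℕ => eVariationOn f (Set.Icc ((k : ℝ) / b) (((k + 1 : ℕ) : ℝ) / b)))
      (fun _ _ => zero_le) hk
  rw [← htotal, ENNReal.toReal_sum hfin, ← Finset.sum_sub_distrib]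
  refine (Finset.abs_sum_le_sum_abs _ _).trans (Finset.sum_le_sum fun k hk => ?_)
  exact BoundedVariationOn.dist_le (hfin k hk) (hmem k s hs) (hmem k t ht)

/-- If `f` has mean zero on `[0,1]`, its sum over equally spaced points is at most its variation. -/
lemma abs_sum_le_variation {f : ℝ → ℝ} (hbv : BoundedVariationOn f (Set.Icc (0 : ℝ) 1))
    (hf : ∀ a b : ℝ, IntervalIntegrable f volume a b) (hmean : (∫ x in (0:ℝ)..1, f x) = 0)
    {b : ℕ} (hb : 0 < b) {s : ℝ} (hs : s ∈ Set.Icc (0 : ℝ) 1) :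
    |∑ k ∈ Finset.range b, f ((s + k) / b)| ≤ (eVariationOn f (Set.Icc (0 : ℝ) 1)).toReal := by
  have hb' : (b : ℝ) ≠ 0 := by positivity
  have hint : ∀ k ∈ Finset.range b,
      IntervalIntegrable (fun t => f ((t + k) / b)) volume 0 1 :=
    fun k _ => intervalIntegrable_comp_add_div hf hb' k 0 1
  have hzero : ∫ t in (0:ℝ)..1, ∑ k ∈ Finset.range b, f ((t + k) / b) = 0 := by
    rw [intervalIntegral.integral_finsetSum hint, ← mul_integral_eq_sum_integral_add_div hb hf,
      hmean, mul_zero]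
  have hsub : ∫ t in (0:ℝ)..1, (∑ k ∈ Finset.range b, f ((s + k) / b) -
      ∑ k ∈ Finset.range b, f ((t + k) / b)) = ∑ k ∈ Finset.range b, f ((s + k) / b) := by
    rw [intervalIntegral.integral_sub (by simp) (by
      simpa only [Finset.sum_fn] using IntervalIntegrable.sum _ hint), hzero]
    simp
  rw [← hsub]
  exact abs_integral_zero_one_le fun t ht => abs_sum_sub_sum_le_variation hbv hb hs ht

lemma Function.Periodic.intervalIntegrable_of_boundedVariationOn {f : ℝ → ℝ}
    (hper : Function.Periodic f 1) (hbv : BoundedVariationOn f (Set.Icc (0 : ℝ) 1)) (a b : ℝ) :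
    IntervalIntegrable f volume a b := by
  obtain ⟨p, q, hp, hq, hpq⟩ := hbv.locallyBoundedVariationOn.exists_monotoneOn_sub_monotoneOn
  refine hper.intervalIntegrable₀ one_ne_zero ?_ a b
  rw [hpq]
  rw [← Set.uIcc_of_le zero_le_one] at hp hq
  exact hp.intervalIntegrable.sub hq.intervalIntegrable

lemma Function.Periodic.exists_abs_le_of_boundedVariationOn {f : ℝ → ℝ}
    (hper : Function.Periodic f 1) (hbv : BoundedVariationOn f (Set.Icc (0 : ℝ) 1)) :
    ∃ B : ℝ, ∀ x, |f x| ≤ B := by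
  refine ⟨(eVariationOn f (Set.Icc (0 : ℝ) 1)).toReal + |f 0|, fun x => ?_⟩
  have hx : f (Int.fract x) = f x := by
    have hsub := hper.sub_int_mul_eq (x := x) ⌊x⌋
    rwa [mul_one] at hsub
  have hd := hbv.dist_le (x := Int.fract x) (y := 0)
    ⟨Int.fract_nonneg x, (Int.fract_lt_one x).le⟩ (by simp)
  rw [Real.dist_eq, hx] at hd
  linarith [abs_sub_abs_le_abs_sub (f x) (f 0)]

lemma Function.Periodic.add_mod_div {f : ℝ → ℝ} (hper : Function.Periodic f 1) {b : ℕ}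
    (hb : 0 < b) (t : ℝ) (k : ℕ) : f ((t + (k % b : ℕ)) / b) = f ((t + k) / b) := by
  have hb' : (b : ℝ) ≠ 0 := by positivity
  have hk : (k : ℝ) = (k % b : ℕ) + b * (k / b : ℕ) := by exact_mod_cast (Nat.mod_add_div k b).symm
  have harg : (t + k) / b = (t + (k % b : ℕ)) / b + (k / b : ℕ) * (1 : ℝ) := by
    rw [hk]
    field_simp
    ring
  rw [harg, hper.nat_mul (k / b : ℕ)]

lemma intervalIntegrable_mul_dilations {f : ℝ → ℝ} {B : ℝ} (hB : ∀ x, |f x| ≤ B)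
    (hf : ∀ a b : ℝ, IntervalIntegrable f volume a b) {m n : ℕ} (hm : 0 < m) (hn : 0 < n)
    (a b : ℝ) :
    IntervalIntegrable (fun x => f ((m : ℝ) * x) * f ((n : ℝ) * x)) volume a b := by
  have hdil : ∀ l : ℕ, 0 < l → IntervalIntegrable (fun x => f ((l : ℝ) * x)) volume a b := by
    intro l hl
    have hl' : (l : ℝ) ≠ 0 := by positivity
    simpa [hl'] using (hf (l * a) (l * b)).comp_mul_left (c := (l : ℝ))
  rw [intervalIntegrable_iff]
  exact (intervalIntegrable_iff.1 (hdil m hm)).mul_bdd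
    (intervalIntegrable_iff.1 (hdil n hn)).aestronglyMeasurable
    (Filter.Eventually.of_forall fun x => hB _)

/-- The dilated correlation for coprime frequencies, as an integral of a product of sums. -/
lemma Function.Periodic.mul_integral_mul_dilations {f : ℝ → ℝ} (hper : Function.Periodic f 1)
    {B : ℝ} (hB : ∀ x, |f x| ≤ B) (hf : ∀ a b : ℝ, IntervalIntegrable f volume a b)
    {a b : ℕ} (ha : 0 < a) (hb : 0 < b) (hab : Nat.Coprime a b) :
    ((a * b : ℕ) : ℝ) * ∫ x in (0:ℝ)..1, f ((a : ℝ) * x) * f ((b : ℝ) * x) =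
      ∫ t in (0:ℝ)..1, (∑ i ∈ Finset.range a, f ((t + i) / a)) *
        ∑ j ∈ Finset.range b, f ((t + j) / b) := by
  have ha' : (a : ℝ) ≠ 0 := by positivity
  have hb' : (b : ℝ) ≠ 0 := by positivity
  have hint := intervalIntegrable_mul_dilations hB hf ha hb
  have hab' : ((a * b : ℕ) : ℝ) ≠ 0 := by positivity
  rw [mul_integral_eq_sum_integral_add_div (Nat.mul_pos ha hb) hint,
    ← intervalIntegral.integral_finsetSum]
  · refine intervalIntegral.integral_congr fun t _ => ?_
    rw [← sum_range_mul_of_coprime ha hb hab (fun i => f ((t + i) / a)) fun j => f ((t + j) / b)]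
    refine Finset.sum_congr rfl fun k _ => ?_
    rw [hper.add_mod_div ha, hper.add_mod_div hb, mul_comm]
    congr 2 <;> (push_cast; field_simp)
  · exact fun k _ => intervalIntegrable_comp_add_div hint hab' k 0 1

/-- A common factor of both frequencies does not change the correlation. -/
lemma Function.Periodic.integral_mul_dilations_common_factor {f : ℝ → ℝ}
    (hper : Function.Periodic f 1) {B : ℝ} (hB : ∀ x, |f x| ≤ B)
    (hf : ∀ a b : ℝ, IntervalIntegrable f volume a b) {g a b : ℕ} (hg : 0 < g) (ha : 0 < a)
    (hb : 0 < b) :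
    ∫ x in (0:ℝ)..1, f (((a * g : ℕ) : ℝ) * x) * f (((b * g : ℕ) : ℝ) * x) =
      ∫ x in (0:ℝ)..1, f ((a : ℝ) * x) * f ((b : ℝ) * x) := by
  have hg' : (g : ℝ) ≠ 0 := by positivity
  refine mul_left_cancel₀ hg' ?_
  rw [mul_integral_eq_sum_integral_add_div hg
    (intervalIntegrable_mul_dilations hB hf (Nat.mul_pos ha hg) (Nat.mul_pos hb hg))]
  have hshift : ∀ (l k : ℕ) (t : ℝ), f (((l * g : ℕ) : ℝ) * ((t + k) / g)) = f (l * t) := by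
    intro l k t
    have harg : ((l * g : ℕ) : ℝ) * ((t + k) / g) = l * t + (l * k : ℕ) * (1 : ℝ) := by
      push_cast
      field_simp
    rw [harg, hper.nat_mul (l * k)]
  simp only [hshift, Finset.sum_const, Finset.card_range, nsmul_eq_mul]

/-- For a 1-periodic function `f` of bounded variation on `[0,1]` with `∫₀¹ f = 0`, there is a
constant `C` (depending only on `f`) such that for all positive integers `m, n`,
`|∫₀¹ f(m x) f(n x) dx| ≤ C · gcd(m,n)² / (m n)`. -/
theorem gcd_bound_for_dilated_correlations (f : ℝ → ℝ)
    (hper : Function.Periodic f 1)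
    (hbv : BoundedVariationOn f (Set.Icc (0 : ℝ) 1))
    (hmean : (∫ x in (0:ℝ)..1, f x) = 0) :
    ∃ C : ℝ, ∀ m n : ℕ, 0 < m → 0 < n →
      |∫ x in (0:ℝ)..1, f ((m : ℝ) * x) * f ((n : ℝ) * x)|
        ≤ C * (Nat.gcd m n : ℝ) ^ 2 / ((m : ℝ) * (n : ℝ)) := by
  have hf := hper.intervalIntegrable_of_boundedVariationOn hbv
  obtain ⟨B, hB⟩ := hper.exists_abs_le_of_boundedVariationOn hbv
  set V := (eVariationOn f (Set.Icc (0 : ℝ) 1)).toReal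
  refine ⟨V * V, fun m n hm hn => ?_⟩
  obtain ⟨a, b, hab, hma, hnb⟩ := Nat.exists_coprime m n
  have hg : 0 < Nat.gcd m n := Nat.gcd_pos_of_pos_left n hm
  set g := Nat.gcd m n
  have ha : 0 < a := Nat.pos_of_mul_pos_right (hma ▸ hm)
  have hb : 0 < b := Nat.pos_of_mul_pos_right (hnb ▸ hn)
  have hprod : |((a * b : ℕ) : ℝ) * ∫ x in (0:ℝ)..1, f ((a : ℝ) * x) * f ((b : ℝ) * x)| ≤
      V * V := by
    rw [hper.mul_integral_mul_dilations hB hf ha hb hab]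
    refine abs_integral_zero_one_le fun t ht => ?_
    rw [abs_mul]
    exact mul_le_mul (abs_sum_le_variation hbv hf hmean ha ht)
      (abs_sum_le_variation hbv hf hmean hb ht) (abs_nonneg _) ENNReal.toReal_nonneg
  rw [hma, hnb, hper.integral_mul_dilations_common_factor hB hf hg ha hb]
  have ha' : (0 : ℝ) < a := by positivity
  have hb' : (0 : ℝ) < b := by positivity
  have hg' : (0 : ℝ) < g := by positivity
  have hab' : (0 : ℝ) < (a * b : ℕ) := by positivity
  rw [abs_mul, abs_of_pos hab', mul_comm, ← le_div_iff₀ hab'] at hprod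
  refine hprod.trans_eq ?_
  push_cast
  field_simp
end

section
/- (Gál's theorem, upper bound) There exists an absolute constant c such that for every N ≥ 3 and every choice of distinct positive integers n_1, …, n_N, ∑_{k=1}^N ∑_{l=1}^N gcd(n_k, n_l)² / (n_k n_l) ≤ c N (log log N)². -/
open Finset

/-- The squared modulus of the truncated geometric series `∑ r ^ j ψ(j x)`, where `ψ` is the
standard additive character of `ZMod M`. -/
noncomputable def geomKernel (M : ℕ) [NeZero M] (r : ℝ) (x : ZMod M) : ℝ :=
  ‖∑ j ∈ range M, (r : ℂ) ^ j * ZMod.stdAddChar (x * (j : ZMod M))‖ ^ 2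

/-- The correlation of `geomKernel M r` with the characters of frequencies `a` and `b`. -/
noncomputable def geomCoeff (M : ℕ) (r : ℝ) (a b : ℕ) : ℝ :=
  ∑ i ∈ range M, ∑ j ∈ range M, if ((i + a : ℕ) : ZMod M) = ((j + b : ℕ) : ZMod M)
    then r ^ (i + j) else 0

lemma conj_stdAddChar {M : ℕ} [NeZero M] (y : ZMod M) :
    (starRingEnd ℂ) (ZMod.stdAddChar y) = ZMod.stdAddChar (-y) := by
  rw [AddChar.map_neg_eq_conj]

lemma sum_geomKernel_mul_stdAddChar {M : ℕ} [NeZero M] (r : ℝ) (a b : ℕ) :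
    ∑ x : ZMod M, (geomKernel M r x : ℂ) * (ZMod.stdAddChar (x * (a : ZMod M)) *
      (starRingEnd ℂ) (ZMod.stdAddChar (x * (b : ZMod M)))) = M * geomCoeff M r a b := by
  have key (x : ZMod M) : (geomKernel M r x : ℂ) * (ZMod.stdAddChar (x * (a : ZMod M)) *
      (starRingEnd ℂ) (ZMod.stdAddChar (x * (b : ZMod M)))) =
      ∑ i ∈ range M, ∑ j ∈ range M, (r : ℂ) ^ (i + j) *
        ZMod.stdAddChar (x * (((i + a : ℕ) : ZMod M) - ((j + b : ℕ) : ZMod M))) := by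
    rw [geomKernel, Complex.ofReal_pow, ← Complex.mul_conj', map_sum, sum_mul_sum, sum_mul]
    refine sum_congr rfl fun i _ ↦ ?_
    rw [sum_mul]
    refine sum_congr rfl fun j _ ↦ ?_
    have e : x * (((i + a : ℕ) : ZMod M) - ((j + b : ℕ) : ZMod M)) =
        x * i + -(x * j) + (x * a + -(x * b)) := by push_cast; ring
    rw [e]
    simp only [AddChar.map_add_eq_mul, map_mul, map_pow, Complex.conj_ofReal, conj_stdAddChar]
    ring
  simp_rw [key]
  rw [sum_comm, geomCoeff]
  push_cast
  rw [mul_sum]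
  refine sum_congr rfl fun i _ ↦ ?_
  rw [sum_comm, mul_sum]
  refine sum_congr rfl fun j _ ↦ ?_
  rw [← mul_sum, AddChar.sum_mulShift _ (ZMod.isPrimitive_stdAddChar M)]
  push_cast
  simp only [sub_eq_zero, ZMod.card]
  split_ifs <;> simp [mul_comm]

lemma natCast_inj_of_lt {M a b : ℕ} (ha : a < M) (hb : b < M) :
    (a : ZMod M) = (b : ZMod M) ↔ a = b := by
  rw [ZMod.natCast_eq_natCast_iff', Nat.mod_eq_of_lt ha, Nat.mod_eq_of_lt hb]

lemma pow_le_geomCoeff {M : ℕ} {r : ℝ} (hr : 0 ≤ r) {a b : ℕ} (ha : a < M) (hb : b < M) :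
    r ^ ((a - b) + (b - a)) ≤ geomCoeff M r a b := by
  have hnn (i j : ℕ) : 0 ≤ if ((i + a : ℕ) : ZMod M) = ((j + b : ℕ) : ZMod M)
    then r ^ (i + j) else 0 := by split_ifs <;> positivity
  rw [geomCoeff]
  refine le_trans ?_ (single_le_sum (fun i _ ↦ sum_nonneg fun j _ ↦ hnn i j)
    (mem_range.2 (show b - a < M by lia)))
  refine le_trans ?_ (single_le_sum (fun j _ ↦ hnn _ j)
    (mem_range.2 (show a - b < M by lia)))
  rw [if_pos (by congr 1; lia), add_comm]

lemma geomCoeff_zero {M : ℕ} {a b : ℕ} (ha : a < M) (hb : b < M) :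
    geomCoeff M 0 a b = if a = b then 1 else 0 := by
  have hM : 0 ∈ range M := mem_range.2 (by lia)
  rw [geomCoeff, sum_eq_single_of_mem 0 hM, sum_eq_single_of_mem 0 hM]
  · simp [natCast_inj_of_lt ha hb]
  · intro j _ hj
    simp [hj]
  · intro i _ hi
    exact sum_eq_zero fun j _ ↦ by simp [hi]

lemma geomKernel_nonneg {M : ℕ} [NeZero M] (r : ℝ) (x : ZMod M) : 0 ≤ geomKernel M r x := by
  unfold geomKernel; positivity

lemma geomKernel_zero {M : ℕ} [NeZero M] (x : ZMod M) : geomKernel M 0 x = 1 := by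
  rw [geomKernel, sum_eq_single_of_mem 0 (mem_range.2 (NeZero.pos M))]
  · simp
  · intro j _ hj
    simp [hj]

lemma geom_sum_le_inv {r : ℝ} (hr : 0 ≤ r) (hr1 : r < 1) (n : ℕ) :
    ∑ j ∈ range n, r ^ j ≤ (1 - r)⁻¹ := by
  rw [← tsum_geometric_of_lt_one hr hr1]
  exact (summable_geometric_of_lt_one hr hr1).sum_le_tsum _ fun i _ ↦ by positivity

lemma sum_geomKernel_le {M : ℕ} [NeZero M] {r : ℝ} (hr : 0 ≤ r) (hr1 : r < 1) :
    ∑ x : ZMod M, geomKernel M r x ≤ M * (1 - r ^ 2)⁻¹ := by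
  have h := sum_geomKernel_mul_stdAddChar (M := M) r 0 0
  simp only [Nat.cast_zero, mul_zero, AddChar.map_zero_eq_one, map_one, mul_one] at h
  have h' : ∑ x : ZMod M, geomKernel M r x = M * geomCoeff M r 0 0 := by exact_mod_cast h
  rw [h']
  gcongr
  refine le_trans (le_of_eq ?_) (geom_sum_le_inv (sq_nonneg r) (by nlinarith) M)
  refine sum_congr rfl fun i hi ↦ ?_
  rw [sum_eq_single_of_mem i hi]
  · simp [← pow_mul, two_mul]
  · intro j hj hji
    rw [if_neg]
    rw [add_zero, add_zero, natCast_inj_of_lt (mem_range.1 hi) (mem_range.1 hj)]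
    simpa using hji.symm

lemma norm_pow_mul_stdAddChar {M : ℕ} [NeZero M] {r : ℝ} (hr : 0 ≤ r) (y : ZMod M) (j : ℕ) :
    ‖(r : ℂ) ^ j * ZMod.stdAddChar y‖ = r ^ j := by
  simp [abs_of_nonneg hr]

lemma geomKernel_le {M : ℕ} [NeZero M] {r : ℝ} (hr : 0 ≤ r) (hr1 : r < 1) (x : ZMod M) :
    geomKernel M r x ≤ ((1 - r)⁻¹) ^ 2 := by
  unfold geomKernel
  gcongr
  refine (norm_sum_le _ _).trans ?_
  simp_rw [norm_pow_mul_stdAddChar hr]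
  exact geom_sum_le_inv hr hr1 M

lemma abs_geomKernel_sub_one_le {M : ℕ} [NeZero M] {r : ℝ} (hr : 0 ≤ r) (hr1 : r ≤ 1 / 2)
    (x : ZMod M) : |geomKernel M r x - 1| ≤ 6 * r := by
  obtain ⟨m, rfl⟩ := Nat.exists_eq_succ_of_ne_zero (NeZero.ne M)
  unfold geomKernel
  set S := ∑ j ∈ range (m + 1), (r : ℂ) ^ j * ZMod.stdAddChar (x * (j : ZMod (m + 1))) with hS
  have h1 : ‖S - 1‖ ≤ 2 * r := by
    rw [hS, sum_range_succ']
    simp only [Nat.cast_zero, mul_zero, AddChar.map_zero_eq_one, pow_zero, mul_one,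
      add_sub_cancel_right]
    refine (norm_sum_le _ _).trans ?_
    simp_rw [norm_pow_mul_stdAddChar hr, pow_succ, ← sum_mul]
    gcongr
    refine (geom_sum_le_inv hr (by linarith) m).trans ?_
    rw [inv_le_comm₀ (by linarith) (by norm_num)]
    linarith
  have h2 : |‖S‖ - 1| ≤ 2 * r := by
    have := abs_norm_sub_norm_le S 1
    rw [norm_one] at this
    exact this.trans h1
  rw [abs_le] at h2 ⊢
  constructor <;> nlinarith [norm_nonneg S]

lemma sum_geomKernel_pow_le {M : ℕ} [NeZero M] {r : ℝ} (hr : 0 ≤ r) (hr1 : r ≤ 1 / 2) {k : ℕ}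
    (hk : 1 ≤ k) (hkr : 6 * (k * r) ≤ 1) :
    ∑ x : ZMod M, geomKernel M r x ^ k ≤ M * (1 + 38 * (k * r) ^ 2) := by
  have hk' : (1 : ℝ) ≤ k := by exact_mod_cast hk
  have hpt (x : ZMod M) : geomKernel M r x ^ k ≤
      1 + k * (geomKernel M r x - 1) + 36 * (k * r) ^ 2 := by
    have hw := abs_geomKernel_sub_one_le hr hr1 x
    set w := geomKernel M r x - 1 with hw'
    have hK : geomKernel M r x = w + 1 := by rw [hw']; ring
    have hkw : |k * w| ≤ 6 * (k * r) := by
      rw [abs_mul, abs_of_nonneg (by positivity : (0 : ℝ) ≤ k)]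
      nlinarith
    have h1 : geomKernel M r x ^ k ≤ Real.exp (k * w) := by
      rw [Real.exp_nat_mul]
      exact pow_le_pow_left₀ (geomKernel_nonneg _ _) (hK ▸ Real.add_one_le_exp w) k
    have h2 := (abs_le.1 (Real.abs_exp_sub_one_sub_id_le (hkw.trans hkr))).2
    have h3 : (k * w) ^ 2 ≤ 36 * (k * r) ^ 2 := by
      have := pow_le_pow_left₀ (abs_nonneg _) hkw 2
      rw [sq_abs] at this
      linarith
    linarith
  refine (sum_le_sum fun x _ ↦ hpt x).trans ?_
  have hsum := sum_geomKernel_le (M := M) hr (by linarith)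
  have hinv : (1 - r ^ 2)⁻¹ ≤ 1 + 2 * r ^ 2 := by
    rw [inv_le_iff_one_le_mul₀ (by nlinarith)]
    nlinarith [mul_nonneg (sq_nonneg r) (by nlinarith : 0 ≤ 1 - 2 * r ^ 2)]
  rw [sum_add_distrib, sum_add_distrib, ← mul_sum, sum_sub_distrib]
  simp only [sum_const, card_univ, ZMod.card, nsmul_eq_mul, mul_one]
  have hM : (0 : ℝ) ≤ M := by positivity
  have h4 : ∑ x : ZMod M, geomKernel M r x - M ≤ M * (2 * r ^ 2) := by
    have := mul_le_mul_of_nonneg_left hinv hM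
    linarith
  have h5 : (k : ℝ) * (∑ x : ZMod M, geomKernel M r x - M) ≤ k * (M * (2 * r ^ 2)) := by gcongr
  have h6 : (k : ℝ) * (M * (2 * r ^ 2)) ≤ M * (2 * (k * r) ^ 2) := by
    have : (k : ℝ) * r ^ 2 ≤ (k * r) ^ 2 := by nlinarith [sq_nonneg r]
    nlinarith
  nlinarith

lemma pow_div_dvd_factorial {p n : ℕ} (hp : p.Prime) : p ^ (n / p) ∣ n.factorial := by
  rw [hp.pow_dvd_factorial_iff (show Nat.log p n < Nat.log p n + 2 by lia)]
  simpa using single_le_sum (f := fun i ↦ n / p ^ i) (fun i _ ↦ Nat.zero_le _)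
    (mem_Ico.2 (show 1 ≤ 1 ∧ 1 < Nat.log p n + 2 by lia))

lemma sum_log_div_primes_le {n : ℕ} (hn : 1 ≤ n) :
    ∑ p ∈ Nat.primesLE n, Real.log p / p ≤ Real.log n + Real.log 4 := by
  have hn0 : (0 : ℝ) < n := by exact_mod_cast hn
  have hdvd : ∏ p ∈ Nat.primesLE n, p ^ (n / p) ∣ n.factorial := by
    refine Finset.prod_dvd_of_isRelPrime ?_ fun p hp ↦ pow_div_dvd_factorial (Nat.mem_primesLE.1 hp).2
    intro p hp q hq hpq
    replace hp := Nat.mem_primesLE.1 hp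
    replace hq := Nat.mem_primesLE.1 hq
    exact Nat.coprime_iff_isRelPrime.1 (Nat.Coprime.pow _ _ ((Nat.coprime_primes hp.2 hq.2).2 hpq))
  have hle : ∏ p ∈ Nat.primesLE n, p ^ (n / p) ≤ n ^ n :=
    (Nat.le_of_dvd (Nat.factorial_pos n) hdvd).trans (Nat.factorial_le_pow n)
  have hlog : ∑ p ∈ Nat.primesLE n, ((n / p : ℕ) : ℝ) * Real.log p ≤ n * Real.log n := by
    have h : Real.log (∏ p ∈ Nat.primesLE n, (p : ℝ) ^ (n / p)) ≤ Real.log ((n : ℝ) ^ n) := by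
      refine Real.log_le_log ?_ (by exact_mod_cast hle)
      refine prod_pos fun p hp ↦ ?_
      have : 0 < p := (Nat.mem_primesLE.1 hp).2.pos
      positivity
    rw [Real.log_prod, Real.log_pow] at h
    · simpa only [Real.log_pow] using h
    · intro p hp
      have : 0 < p := (Nat.mem_primesLE.1 hp).2.pos
      positivity
  have htheta := Chebyshev.theta_le_log4_mul_x hn0.le
  rw [Chebyshev.theta_eq_sum_primesLE_log] at htheta
  have hterm : ∀ p ∈ Nat.primesLE n, n * (Real.log p / p) ≤
      ((n / p : ℕ) : ℝ) * Real.log p + Real.log p := by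
    intro p hp
    have hp' : p.Prime := (Nat.mem_primesLE.1 hp).2
    have h1 : (n : ℝ) / p ≤ (n / p : ℕ) + 1 := by
      rw [← Nat.floor_div_eq_div (K := ℝ)]
      exact (Nat.lt_floor_add_one _).le
    have h2 : 0 ≤ Real.log p := Real.log_natCast_nonneg p
    calc n * (Real.log p / p) = n / p * Real.log p := by ring
      _ ≤ ((n / p : ℕ) + 1) * Real.log p := by gcongr
      _ = _ := by ring
  have := sum_le_sum hterm
  rw [← mul_sum, sum_add_distrib] at this
  have h3 : n * ∑ p ∈ Nat.primesLE n, Real.log p / p ≤ n * (Real.log n + Real.log 4) := by linarith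
  exact le_of_mul_le_mul_left h3 hn0

lemma tsum_rpow_neg_le {s : ℝ} (hs : 1 < s) :
    ∑' n : ℕ, ((n : ℝ) ^ s)⁻¹ ≤ 1 + 1 / (s - 1) := by
  have hsum : Summable fun n : ℕ ↦ ((n : ℝ) ^ s)⁻¹ := Real.summable_nat_rpow_inv.2 hs
  rw [hsum.tsum_eq_zero_add]
  have h := ZetaAsymptotics.zeta_limit_aux1 hs
  have h0 : 0 ≤ ZetaAsymptotics.termTSum s := tsum_nonneg fun n ↦ ZetaAsymptotics.term_nonneg _ _
  have h1 : ((((0 : ℕ) : ℝ)) ^ s)⁻¹ = 0 := by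
    rw [Nat.cast_zero, Real.zero_rpow (by linarith), inv_zero]
  simp only [one_div] at h ⊢
  push_cast at h1 ⊢
  rw [h1]
  nlinarith [mul_nonneg (by linarith : 0 ≤ s) h0]

lemma prod_one_sub_rpow_inv_le {s : ℝ} (hs : 1 < s) (n : ℕ) :
    ∏ p ∈ Nat.primesLE n, (1 - ((p : ℝ) ^ s)⁻¹)⁻¹ ≤ 1 + 1 / (s - 1) := by
  let f : ℕ →* ℝ :=
    { toFun := fun n ↦ ((n : ℝ) ^ s)⁻¹
      map_one' := by simp
      map_mul' := fun a b ↦ by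
        push_cast
        rw [Real.mul_rpow (by positivity) (by positivity), mul_inv] }
  have hsum : Summable f := Real.summable_nat_rpow_inv.2 hs
  have h := EulerProduct.prod_filter_prime_geometric_eq_tsum_factoredNumbers hsum (range (n + 1))
  have h2 : (range (n + 1)).filter Nat.Prime = Nat.primesLE n := by
    ext p; simp [Nat.mem_primesLE]
  rw [h2] at h
  have h3 : ∏ p ∈ Nat.primesLE n, (1 - ((p : ℝ) ^ s)⁻¹)⁻¹ = ∏ p ∈ Nat.primesLE n, (1 - f p)⁻¹ := rfl
  rw [h3, h]
  refine (hsum.tsum_subtype_le _ _ fun m ↦ ?_).trans (tsum_rpow_neg_le hs)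
  change 0 ≤ ((m : ℝ) ^ s)⁻¹
  positivity

lemma one_sub_inv_inv_le {p s : ℝ} (hp : 2 ≤ p) (hs : 1 < s) :
    (1 - p⁻¹)⁻¹ ≤ Real.exp (2 * (s - 1) * (Real.log p / p)) * (1 - (p ^ s)⁻¹)⁻¹ := by
  have hp0 : 0 < p := by linarith
  have hpinv : p⁻¹ ≤ 1 / 2 := by rw [inv_le_comm₀ hp0 (by norm_num)]; linarith
  have hpi0 : 0 < p⁻¹ := by positivity
  have hq : (p ^ s)⁻¹ = p⁻¹ * Real.exp (-((s - 1) * Real.log p)) := by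
    rw [Real.rpow_def_of_pos hp0, ← Real.exp_neg]
    nth_rewrite 2 [← Real.exp_log hp0]
    rw [← Real.exp_neg, ← Real.exp_add]
    congr 1; ring
  have he := Real.add_one_le_exp (-((s - 1) * Real.log p))
  have hlp : 0 ≤ Real.log p := Real.log_nonneg (by linarith)
  have hu : 0 ≤ (s - 1) * Real.log p := mul_nonneg (by linarith) hlp
  have hq1 : (p ^ s)⁻¹ ≤ p⁻¹ := by
    rw [hq]
    have : Real.exp (-((s - 1) * Real.log p)) ≤ 1 := Real.exp_le_one_iff.2 (by linarith)
    nlinarith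
  have hlow : p⁻¹ - (p ^ s)⁻¹ ≤ p⁻¹ * ((s - 1) * Real.log p) := by
    rw [hq]; nlinarith
  have hexp := Real.add_one_le_exp (2 * (s - 1) * (Real.log p / p))
  rw [inv_le_iff_one_le_mul₀ (by linarith), mul_right_comm, ← div_eq_mul_inv,
    le_div_iff₀ (by linarith), one_mul]
  have e : 2 * (s - 1) * (Real.log p / p) = 2 * (p⁻¹ * ((s - 1) * Real.log p)) := by
    field_simp
  rw [e] at hexp ⊢
  have : 0 ≤ p⁻¹ * ((s - 1) * Real.log p) := by positivity
  nlinarith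

/-- The upper bound in Mertens' third theorem. -/
lemma prod_one_sub_inv_primesLE_le {n : ℕ} (hn : 3 ≤ n) :
    ∏ p ∈ Nat.primesLE n, (1 - (p : ℝ)⁻¹)⁻¹ ≤ 2 * Real.exp 6 * Real.log n := by
  have hn3 : (3 : ℝ) ≤ n := by exact_mod_cast hn
  have hlog : 1 ≤ Real.log n := by
    rw [Real.le_log_iff_exp_le (by linarith)]
    linarith [Real.exp_one_lt_d9]
  set s := 1 + 1 / Real.log n with hs
  have hl0 : 0 < 1 / Real.log n := by positivity
  have hs1 : s - 1 = 1 / Real.log n := by rw [hs]; ring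
  have hs' : 1 < s := by linarith
  have hp2 : ∀ p ∈ Nat.primesLE n, (2 : ℝ) ≤ p := fun p hp ↦ by
    exact_mod_cast (Nat.mem_primesLE.1 hp).2.two_le
  have h1 : ∏ p ∈ Nat.primesLE n, (1 - (p : ℝ)⁻¹)⁻¹ ≤ ∏ p ∈ Nat.primesLE n,
      (Real.exp (2 * (s - 1) * (Real.log p / p)) * (1 - ((p : ℝ) ^ s)⁻¹)⁻¹) := by
    refine prod_le_prod (fun p hp ↦ ?_) fun p hp ↦ one_sub_inv_inv_le (hp2 p hp) hs'
    have := inv_le_one_of_one_le₀ (by linarith [hp2 p hp] : (1 : ℝ) ≤ p)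
    exact inv_nonneg.2 (by linarith)
  refine h1.trans ?_
  rw [prod_mul_distrib, ← Real.exp_sum, ← mul_sum]
  have h2 := prod_one_sub_rpow_inv_le hs' n
  have h3 : 2 * (s - 1) * ∑ p ∈ Nat.primesLE n, Real.log p / p ≤ 6 := by
    have h4 := sum_log_div_primes_le (by lia : 1 ≤ n)
    have h5 : Real.log 4 ≤ 2 := by
      rw [show (4 : ℝ) = 2 ^ 2 by norm_num, Real.log_pow]
      have := Real.log_two_lt_d9
      push_cast; linarith
    rw [hs1, mul_one_div, div_mul_eq_mul_div, div_le_iff₀ (by linarith)]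
    linarith
  rw [hs1, one_div_one_div] at h2
  calc _ ≤ Real.exp 6 * (1 + Real.log n) := by
        refine mul_le_mul (Real.exp_le_exp.2 h3) h2 (prod_nonneg fun p hp ↦ ?_) (Real.exp_pos _).le
        refine inv_nonneg.2 (sub_nonneg.2 (inv_le_one_of_one_le₀ ?_))
        exact Real.one_le_rpow (by linarith [hp2 p hp]) (by linarith)
    _ ≤ _ := by nlinarith [Real.exp_pos 6]

section Expectation

variable {ι α : Type*} [Fintype ι]

/-- The sum over `a ∈ S` of the characters of `ι → ZMod M` with frequency vectors `v a`. -/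
noncomputable def charSum (M : ℕ) [NeZero M] (S : Finset α) (v : α → ι → ℕ) (x : ι → ZMod M) : ℂ :=
  ∑ a ∈ S, ∏ p, ZMod.stdAddChar (x p * (v a p : ZMod M))

lemma norm_charSum_le {M : ℕ} [NeZero M] (S : Finset α) (v : α → ι → ℕ) (x : ι → ZMod M) :
    ‖charSum M S v x‖ ≤ #S := by
  refine (norm_sum_le _ _).trans (le_of_eq ?_)
  simp

variable [DecidableEq ι]

lemma sum_prod_geomKernel_mul_charSum {M : ℕ} [NeZero M] (r : ι → ℝ) (S : Finset α)
    (v : α → ι → ℕ) :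
    ∑ x : ι → ZMod M, (∏ p, geomKernel M (r p) (x p)) * ‖charSum M S v x‖ ^ 2 =
      M ^ Fintype.card ι * ∑ a ∈ S, ∑ b ∈ S, ∏ p, geomCoeff M (r p) (v a p) (v b p) := by
  have key (x : ι → ZMod M) :
      (((∏ p, geomKernel M (r p) (x p)) * ‖charSum M S v x‖ ^ 2 : ℝ) : ℂ) =
      ∑ a ∈ S, ∑ b ∈ S, ∏ p, ((geomKernel M (r p) (x p) : ℂ) *
        (ZMod.stdAddChar (x p * (v a p : ZMod M)) *
          (starRingEnd ℂ) (ZMod.stdAddChar (x p * (v b p : ZMod M))))) := by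
    push_cast
    rw [← Complex.mul_conj', charSum, map_sum, sum_mul_sum, mul_sum]
    refine sum_congr rfl fun a _ ↦ ?_
    rw [mul_sum]
    refine sum_congr rfl fun b _ ↦ ?_
    rw [map_prod, prod_mul_distrib, prod_mul_distrib]
  have h : ((∑ x : ι → ZMod M, (∏ p, geomKernel M (r p) (x p)) * ‖charSum M S v x‖ ^ 2 : ℝ) : ℂ) =
      ((M ^ Fintype.card ι * ∑ a ∈ S, ∑ b ∈ S, ∏ p, geomCoeff M (r p) (v a p) (v b p) : ℝ) : ℂ) := by
    rw [Complex.ofReal_sum]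
    simp_rw [key]
    rw [sum_comm]
    push_cast
    rw [mul_sum]
    refine sum_congr rfl fun a _ ↦ ?_
    rw [sum_comm, mul_sum]
    refine sum_congr rfl fun b _ ↦ ?_
    rw [← Fintype.prod_sum fun (p : ι) (y : ZMod M) ↦ (geomKernel M (r p) y : ℂ) *
      (ZMod.stdAddChar (y * (v a p : ZMod M)) *
        (starRingEnd ℂ) (ZMod.stdAddChar (y * (v b p : ZMod M))))]
    simp_rw [sum_geomKernel_mul_stdAddChar]
    rw [prod_mul_distrib, prod_const, card_univ]
  exact_mod_cast h

lemma sum_norm_charSum_sq {M : ℕ} [NeZero M] {S : Finset α} {v : α → ι → ℕ}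
    (hv : ∀ a ∈ S, ∀ p, v a p < M) (hinj : ∀ a ∈ S, ∀ b ∈ S, v a = v b → a = b) :
    ∑ x : ι → ZMod M, ‖charSum M S v x‖ ^ 2 = M ^ Fintype.card ι * #S := by
  classical
  have h := sum_prod_geomKernel_mul_charSum (M := M) (fun _ : ι ↦ 0) S v
  simp only [geomKernel_zero, prod_const_one, one_mul] at h
  rw [h, card_eq_sum_ones]
  push_cast
  congr 1
  refine sum_congr rfl fun a ha ↦ ?_
  rw [sum_eq_single_of_mem a ha]
  · exact prod_eq_one fun p _ ↦ by rw [geomCoeff_zero (hv a ha p) (hv a ha p), if_pos rfl]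
  · intro b hb hba
    obtain ⟨p, hp⟩ : ∃ p, v a p ≠ v b p := by
      by_contra! hcon
      exact hba (hinj a ha b hb (funext hcon)).symm
    refine prod_eq_zero (mem_univ p) ?_
    rw [geomCoeff_zero (hv a ha p) (hv b hb p), if_neg hp]

lemma le_add_pow_div_pow {g V : ℝ} (hg : 0 ≤ g) (hV : 0 < V) (k : ℕ) :
    g ≤ V + g ^ (k + 1) / V ^ k := by
  rcases le_total g V with h | h
  · have : 0 ≤ g ^ (k + 1) / V ^ k := by positivity
    linarith
  · have : g ≤ g ^ (k + 1) / V ^ k := by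
      rw [le_div_iff₀ (by positivity), pow_succ, mul_comm]
      gcongr
    linarith

lemma sum_prod_pow_le {M : ℕ} [NeZero M] {S : Finset α} {v : α → ι → ℕ} {r : ι → ℝ}
    (hr : ∀ p, 0 ≤ r p) (hv : ∀ a ∈ S, ∀ p, v a p < M)
    (hinj : ∀ a ∈ S, ∀ b ∈ S, v a = v b → a = b) {V : ℝ} (hV : 0 < V) (k : ℕ) {c : ι → ℝ}
    (hc : ∀ p, ∑ x : ZMod M, geomKernel M (r p) x ^ (k + 1) ≤ M * c p) :
    ∑ a ∈ S, ∑ b ∈ S, ∏ p, r p ^ ((v a p - v b p) + (v b p - v a p)) ≤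
      V * #S + #S ^ 2 * (∏ p, c p) / V ^ k := by
  set G : (ι → ZMod M) → ℝ := fun x ↦ ∏ p, geomKernel M (r p) (x p) with hG
  have hG0 (x : ι → ZMod M) : 0 ≤ G x := prod_nonneg fun p _ ↦ geomKernel_nonneg _ _
  have hM : (0 : ℝ) < M ^ Fintype.card ι := by
    have : 0 < M := NeZero.pos M
    positivity
  have hpt (x : ι → ZMod M) : G x * ‖charSum M S v x‖ ^ 2 ≤
      V * ‖charSum M S v x‖ ^ 2 + #S ^ 2 / V ^ k * G x ^ (k + 1) := by
    have h1 := le_add_pow_div_pow (hG0 x) hV k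
    have h2 : ‖charSum M S v x‖ ^ 2 ≤ (#S : ℝ) ^ 2 := by
      have := norm_charSum_le S v x
      gcongr
    have h3 : 0 ≤ G x ^ (k + 1) / V ^ k := by have := hG0 x; positivity
    calc G x * ‖charSum M S v x‖ ^ 2
        ≤ (V + G x ^ (k + 1) / V ^ k) * ‖charSum M S v x‖ ^ 2 := by gcongr
      _ = V * ‖charSum M S v x‖ ^ 2 + G x ^ (k + 1) / V ^ k * ‖charSum M S v x‖ ^ 2 := by ring
      _ ≤ V * ‖charSum M S v x‖ ^ 2 + G x ^ (k + 1) / V ^ k * (#S : ℝ) ^ 2 := by gcongr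
      _ = _ := by ring
  have hmom : ∑ x, G x ^ (k + 1) ≤ M ^ Fintype.card ι * ∏ p, c p := by
    simp_rw [hG, ← prod_pow]
    rw [← Fintype.prod_sum fun (p : ι) (x : ZMod M) ↦ geomKernel M (r p) x ^ (k + 1),
      Fintype.card, ← prod_const, ← prod_mul_distrib]
    refine prod_le_prod (fun p _ ↦ sum_nonneg fun x _ ↦ ?_) fun p _ ↦ hc p
    exact pow_nonneg (geomKernel_nonneg _ _) _
  have hlow : ∑ a ∈ S, ∑ b ∈ S, ∏ p, r p ^ ((v a p - v b p) + (v b p - v a p)) ≤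
      ∑ a ∈ S, ∑ b ∈ S, ∏ p, geomCoeff M (r p) (v a p) (v b p) := by
    gcongr with a ha b hb p hp
    · intro p _
      exact pow_nonneg (hr p) _
    · exact pow_le_geomCoeff (hr p) (hv a ha p) (hv b hb p)
  refine hlow.trans (le_of_mul_le_mul_left ?_ hM)
  rw [← sum_prod_geomKernel_mul_charSum]
  refine (sum_le_sum fun x _ ↦ hpt x).trans ?_
  rw [sum_add_distrib, ← mul_sum, ← mul_sum, sum_norm_charSum_sq hv hinj]
  have h5 : (#S : ℝ) ^ 2 / V ^ k * ∑ x, G x ^ (k + 1) ≤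
      #S ^ 2 / V ^ k * (M ^ Fintype.card ι * ∏ p, c p) := by gcongr
  calc _ ≤ V * (M ^ Fintype.card ι * #S) + #S ^ 2 / V ^ k * (M ^ Fintype.card ι * ∏ p, c p) := by
        gcongr
    _ = _ := by ring

end Expectation

lemma gcd_sq_div_mul_eq_prod {Q a b : ℕ} (ha : a ≠ 0) (hb : b ≠ 0) (haQ : a ≤ Q) (hbQ : b ≤ Q) :
    (Nat.gcd a b : ℝ) ^ 2 / (a * b) = ∏ p ∈ Nat.primesLE Q, ((p : ℝ)⁻¹) ^
      ((a.factorization p - b.factorization p) + (b.factorization p - a.factorization p)) := by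
  have hprod {m : ℕ} (hm : m ≠ 0) (hmQ : m ≤ Q) :
      (m : ℝ) = ∏ p ∈ Nat.primesLE Q, (p : ℝ) ^ m.factorization p := by
    have h : m.factorization.prod (fun p e ↦ p ^ e) =
        ∏ p ∈ Nat.primesLE Q, p ^ m.factorization p := by
      refine Finsupp.prod_of_support_subset _ (fun p hp ↦ ?_) _ (by simp)
      rw [Nat.support_factorization] at hp
      exact Nat.mem_primesLE.2 ⟨(Nat.le_of_mem_primeFactors hp).trans hmQ,
        Nat.prime_of_mem_primeFactors hp⟩
    rw [Nat.prod_factorization_pow_eq_self hm] at h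
    exact_mod_cast h
  have hg : Nat.gcd a b ≠ 0 := Nat.gcd_ne_zero_left ha
  rw [hprod hg ((Nat.gcd_le_left b (Nat.pos_of_ne_zero ha)).trans haQ), hprod ha haQ, hprod hb hbQ,
    ← prod_pow, ← prod_mul_distrib, ← prod_div_distrib]
  refine prod_congr rfl fun p hp ↦ ?_
  have hp0 : (p : ℝ) ≠ 0 := by exact_mod_cast (Nat.mem_primesLE.1 hp).2.ne_zero
  rw [Nat.factorization_gcd ha hb, Finsupp.inf_apply, inv_pow, ← pow_mul, ← pow_add,
    div_eq_iff (by positivity), ← div_eq_inv_mul, eq_div_iff (by positivity), ← pow_add]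
  congr 1
  rcases le_total (a.factorization p) (b.factorization p) with h | h <;> simp [h] <;> lia

/-- The bound for the `k`-th moment of the local factor at `p`. -/
noncomputable def localMoment (k p : ℕ) : ℝ :=
  if p ≤ 8 * k then (((1 - (p : ℝ)⁻¹)⁻¹) ^ 2) ^ k else 1 + 38 * (k * (p : ℝ)⁻¹) ^ 2

lemma sum_geomKernel_pow_le_localMoment {M k p : ℕ} [NeZero M] (hk : 1 ≤ k) (hp : 2 ≤ p) :
    ∑ x : ZMod M, geomKernel M (p : ℝ)⁻¹ x ^ k ≤ M * localMoment k p := by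
  have hp' : (2 : ℝ) ≤ p := by exact_mod_cast hp
  have hr : (p : ℝ)⁻¹ ≤ 1 / 2 := by rw [inv_le_comm₀ (by linarith) (by norm_num)]; linarith
  unfold localMoment
  split_ifs with h
  · have h2 : ∀ x ∈ (univ : Finset (ZMod M)), geomKernel M (p : ℝ)⁻¹ x ^ k ≤
        (((1 - (p : ℝ)⁻¹)⁻¹) ^ 2) ^ k := fun x _ ↦
      pow_le_pow_left₀ (geomKernel_nonneg _ _) (geomKernel_le (by positivity) (by linarith) x) k
    simpa using sum_le_card_nsmul _ _ _ h2
  · refine sum_geomKernel_pow_le (by positivity) hr hk ?_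
    have h3 : (8 * k : ℝ) ≤ p := by exact_mod_cast (not_le.1 h).le
    rw [← div_eq_mul_inv, mul_div_assoc', div_le_one (by linarith)]
    linarith [(Nat.cast_nonneg k : (0 : ℝ) ≤ k)]

lemma prod_localMoment_le {k : ℕ} (hk : 1 ≤ k) (Q : ℕ) :
    ∏ p ∈ Nat.primesLE Q, localMoment k p ≤
      (Real.exp 10 * (2 * Real.exp 6 * Real.log (8 * k : ℕ)) ^ 2) ^ k := by
  have hk' : (1 : ℝ) ≤ k := by exact_mod_cast hk
  have hone {p : ℕ} (hp : p.Prime) : 1 ≤ (1 - (p : ℝ)⁻¹)⁻¹ := by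
    have hp' : (2 : ℝ) ≤ p := by exact_mod_cast hp.two_le
    have : (p : ℝ)⁻¹ ≤ 1 / 2 := by rw [inv_le_comm₀ (by linarith) (by norm_num)]; linarith
    have : 0 < (p : ℝ)⁻¹ := by positivity
    exact (one_le_inv₀ (by linarith)).2 (by linarith)
  rw [← prod_filter_mul_prod_filter_not (Nat.primesLE Q) (fun p ↦ p ≤ 8 * k)]
  have hsmall : ∏ p ∈ Nat.primesLE Q with p ≤ 8 * k, localMoment k p ≤
      ((2 * Real.exp 6 * Real.log (8 * k : ℕ)) ^ 2) ^ k := by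
    calc _ = ((∏ p ∈ Nat.primesLE Q with p ≤ 8 * k, (1 - (p : ℝ)⁻¹)⁻¹) ^ 2) ^ k := by
          rw [← prod_pow, ← prod_pow]
          refine prod_congr rfl fun p hp ↦ ?_
          rw [localMoment, if_pos (mem_filter.1 hp).2]
      _ ≤ ((∏ p ∈ Nat.primesLE (8 * k), (1 - (p : ℝ)⁻¹)⁻¹) ^ 2) ^ k := by
          have h0 : 0 ≤ ∏ p ∈ Nat.primesLE Q with p ≤ 8 * k, (1 - (p : ℝ)⁻¹)⁻¹ :=
            prod_nonneg fun p hp ↦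
              zero_le_one.trans (hone (Nat.mem_primesLE.1 (mem_filter.1 hp).1).2)
          refine pow_le_pow_left₀ (by positivity) (pow_le_pow_left₀ h0 ?_ 2) k
          refine prod_le_prod_of_subset_of_one_le (fun p hp ↦ ?_) (fun p hp ↦ ?_)
            fun p hp _ ↦ hone (Nat.mem_primesLE.1 hp).2
          · rw [mem_filter, Nat.mem_primesLE] at hp
            exact Nat.mem_primesLE.2 ⟨hp.2, hp.1.2⟩
          · exact zero_le_one.trans (hone (Nat.mem_primesLE.1 (mem_filter.1 hp).1).2)
      _ ≤ _ := by
          have h0 : 0 ≤ ∏ p ∈ Nat.primesLE (8 * k), (1 - (p : ℝ)⁻¹)⁻¹ :=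
            prod_nonneg fun p hp ↦ zero_le_one.trans (hone (Nat.mem_primesLE.1 hp).2)
          gcongr
          exact prod_one_sub_inv_primesLE_le (by lia)
  have hlarge : ∏ p ∈ Nat.primesLE Q with ¬ p ≤ 8 * k, localMoment k p ≤ Real.exp 10 ^ k := by
    calc _ ≤ ∏ p ∈ Nat.primesLE Q with ¬ p ≤ 8 * k,
          Real.exp (38 * (k : ℝ) ^ 2 * ((p : ℝ) ^ 2)⁻¹) := by
          refine prod_le_prod (fun p hp ↦ ?_) fun p hp ↦ ?_ <;>
            rw [localMoment, if_neg (mem_filter.1 hp).2]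
          · positivity
          · refine (le_of_eq ?_).trans (Real.add_one_le_exp _)
            rw [mul_pow, inv_pow]; ring
      _ = Real.exp (38 * (k : ℝ) ^ 2 * ∑ p ∈ Nat.primesLE Q with ¬ p ≤ 8 * k,
            ((p : ℝ) ^ 2)⁻¹) := by rw [← Real.exp_sum, mul_sum]
      _ ≤ Real.exp (k * 10) := by
          have h1 : ∑ p ∈ Nat.primesLE Q with ¬ p ≤ 8 * k, ((p : ℝ) ^ 2)⁻¹ ≤
              ∑ p ∈ Ioo (8 * k) (Q + 1), ((p : ℝ) ^ 2)⁻¹ := by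
            refine sum_le_sum_of_subset_of_nonneg (fun p hp ↦ ?_) fun p _ _ ↦ by positivity
            rw [mem_filter, Nat.mem_primesLE] at hp
            rw [mem_Ioo]
            lia
          have h2 := sum_Ioo_inv_sq_le (α := ℝ) (8 * k) (Q + 1)
          have h3 : (2 : ℝ) / ((8 * k : ℕ) + 1) ≤ 2 / (8 * k) := by
            push_cast
            gcongr
            linarith
          have h4 := mul_le_mul_of_nonneg_left (h1.trans (h2.trans h3))
            (by positivity : (0 : ℝ) ≤ 38 * (k : ℝ) ^ 2)
          refine Real.exp_le_exp.2 (h4.trans ?_)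
          rw [mul_div_assoc', div_le_iff₀ (by positivity)]
          nlinarith
      _ = _ := Real.exp_nat_mul _ _
  rw [mul_pow, mul_comm]
  refine mul_le_mul hlarge hsmall (prod_nonneg fun p hp ↦ ?_) (by positivity)
  unfold localMoment
  split_ifs <;> positivity

lemma sum_gcd_sq_div_mul_le {S : Finset ℕ} (hS : ∀ a ∈ S, a ≠ 0) {k : ℕ} (hk : 1 ≤ k)
    (hkS : (#S : ℝ) ≤ Real.exp k) :
    ∑ a ∈ S, ∑ b ∈ S, (Nat.gcd a b : ℝ) ^ 2 / (a * b) ≤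
      2 * Real.exp 1 * Real.exp 10 * (2 * Real.exp 6 * Real.log (8 * k : ℕ)) ^ 2 * #S := by
  obtain ⟨Q, hQ⟩ := S.exists_le
  obtain ⟨m, rfl⟩ := Nat.exists_eq_add_of_le' hk
  set B := Real.exp 10 * (2 * Real.exp 6 * Real.log (8 * (m + 1) : ℕ)) ^ 2 with hB
  have hB0 : 0 < B := by
    have : 0 < Real.log (8 * (m + 1) : ℕ) := Real.log_pos (by push_cast; linarith)
    positivity
  have hsum : ∑ a ∈ S, ∑ b ∈ S, (Nat.gcd a b : ℝ) ^ 2 / (a * b) =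
      ∑ a ∈ S, ∑ b ∈ S, ∏ p : Nat.primesLE Q, ((p : ℕ) : ℝ)⁻¹ ^
        ((a.factorization p - b.factorization p) + (b.factorization p - a.factorization p)) := by
    refine sum_congr rfl fun a ha ↦ sum_congr rfl fun b hb ↦ ?_
    rw [gcd_sq_div_mul_eq_prod (hS a ha) (hS b hb) (hQ a ha) (hQ b hb), ← prod_coe_sort]
  have hinj : ∀ a ∈ S, ∀ b ∈ S, (fun p : Nat.primesLE Q ↦ a.factorization p) =
      (fun p : Nat.primesLE Q ↦ b.factorization p) → a = b := by
    intro a ha b hb hab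
    refine Nat.eq_of_factorization_eq (hS a ha) (hS b hb) fun p ↦ ?_
    by_cases hp : p ∈ Nat.primesLE Q
    · exact congrFun hab ⟨p, hp⟩
    · have hz {c : ℕ} (hc : c ∈ S) : c.factorization p = 0 := by
        by_cases hpp : p.Prime
        · refine Nat.factorization_eq_zero_of_lt ((hQ c hc).trans_lt ?_)
          by_contra! hcon
          exact hp (Nat.mem_primesLE.2 ⟨hcon, hpp⟩)
        · exact Nat.factorization_eq_zero_of_not_prime _ hpp
      rw [hz ha, hz hb]
  have hmain := sum_prod_pow_le (M := Q + 1) (S := S)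
    (v := fun a (p : Nat.primesLE Q) ↦ a.factorization p) (r := fun p ↦ ((p : ℕ) : ℝ)⁻¹)
    (fun p ↦ by positivity)
    (fun a ha p ↦ ((Nat.factorization_lt p (hS a ha)).trans_le (hQ a ha)).trans (Nat.lt_succ_self Q))
    hinj (V := Real.exp 1 * B) (by positivity) m (c := fun p ↦ localMoment (m + 1) p)
    (fun p ↦ sum_geomKernel_pow_le_localMoment hk (Nat.mem_primesLE.1 p.2).2.two_le)
  rw [hsum]
  refine hmain.trans ?_
  have hmom : ∏ p : Nat.primesLE Q, localMoment (m + 1) p ≤ B ^ (m + 1) := by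
    rw [prod_coe_sort (Nat.primesLE Q) (localMoment (m + 1))]
    exact prod_localMoment_le hk Q
  have h2 : (#S : ℝ) ^ 2 * (∏ p : Nat.primesLE Q, localMoment (m + 1) p) / (Real.exp 1 * B) ^ m ≤
      Real.exp 1 * B * #S := by
    rw [div_le_iff₀ (by positivity)]
    calc _ ≤ (#S : ℝ) ^ 2 * B ^ (m + 1) := by gcongr
      _ ≤ #S * Real.exp (m + 1 : ℕ) * B ^ (m + 1) := by rw [sq]; gcongr
      _ = _ := by
        rw [← mul_one (((m + 1 : ℕ) : ℝ)), Real.exp_nat_mul]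
        ring
  calc _ ≤ Real.exp 1 * B * #S + Real.exp 1 * B * #S := by gcongr
    _ = _ := by rw [hB]; ring

lemma log_eight_mul_ceil_log_le {N : ℕ} (hN : 3 ≤ N) :
    Real.log (8 * ⌈Real.log N⌉₊ : ℕ) ≤
      (1 + Real.log 16 / Real.log (Real.log 3)) * Real.log (Real.log N) := by
  have hN' : (3 : ℝ) ≤ N := by exact_mod_cast hN
  have h3 : 1 < Real.log 3 := by
    rw [Real.lt_log_iff_exp_lt (by norm_num)]
    linarith [Real.exp_one_lt_d9]
  have hlog : Real.log 3 ≤ Real.log N := Real.log_le_log (by norm_num) hN'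
  have hll0 : 0 < Real.log (Real.log 3) := Real.log_pos h3
  have hll : Real.log (Real.log 3) ≤ Real.log (Real.log N) := Real.log_le_log (by linarith) hlog
  have hceil := Nat.ceil_lt_add_one (by linarith : 0 ≤ Real.log N)
  have hpos : 0 < ⌈Real.log N⌉₊ := Nat.ceil_pos.2 (by linarith)
  have h1 : Real.log (8 * ⌈Real.log N⌉₊ : ℕ) ≤ Real.log (16 * Real.log N) := by
    refine Real.log_le_log (by positivity) ?_
    push_cast
    linarith
  rw [Real.log_mul (by norm_num) (by linarith)] at h1
  have h2 : Real.log 16 ≤ Real.log 16 / Real.log (Real.log 3) * Real.log (Real.log N) := by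
    rw [div_mul_eq_mul_div, le_div_iff₀ hll0]
    have : 0 ≤ Real.log 16 := Real.log_nonneg (by norm_num)
    gcongr
  linarith

/-- (Gál's theorem, upper bound) There is an absolute constant `c` such that for every `N ≥ 3`
and all distinct positive integers `n_1, …, n_N`,
`∑_{k=1}^N ∑_{l=1}^N gcd(n_k, n_l)² / (n_k n_l) ≤ c N (log log N)²`. -/
theorem gal_gcd_sum_bound :
    ∃ c : ℝ, ∀ N : ℕ, 3 ≤ N → ∀ n : ℕ → ℕ,
      (∀ k ∈ Finset.Icc 1 N, 0 < n k) →
      (∀ k ∈ Finset.Icc 1 N, ∀ l ∈ Finset.Icc 1 N, n k = n l → k = l) →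
      ∑ k ∈ Finset.Icc 1 N, ∑ l ∈ Finset.Icc 1 N,
          (Nat.gcd (n k) (n l) : ℝ) ^ 2 / ((n k : ℝ) * (n l : ℝ))
        ≤ c * N * (Real.log (Real.log N)) ^ 2 := by
  refine ⟨2 * Real.exp 1 * Real.exp 10 *
    (2 * Real.exp 6 * (1 + Real.log 16 / Real.log (Real.log 3))) ^ 2, fun N hN n hpos hinj ↦ ?_⟩
  have hinj' : Set.InjOn n (Icc 1 N) := fun k hk l hl ↦ hinj k hk l hl
  have hN' : (3 : ℝ) ≤ N := by exact_mod_cast hN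
  have hcard : #((Icc 1 N).image n) = N := by rw [card_image_of_injOn hinj', Nat.card_Icc]; lia
  have hS : ∀ a ∈ (Icc 1 N).image n, a ≠ 0 := by
    intro a ha
    obtain ⟨k, hk, rfl⟩ := mem_image.1 ha
    exact (hpos k hk).ne'
  have hk : 1 ≤ ⌈Real.log N⌉₊ := Nat.ceil_pos.2 (Real.log_pos (by linarith))
  have hkS : (#((Icc 1 N).image n) : ℝ) ≤ Real.exp ⌈Real.log N⌉₊ := by
    rw [hcard]
    exact (Real.log_le_iff_le_exp (by linarith)).1 (Nat.le_ceil _)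
  have h := sum_gcd_sq_div_mul_le hS hk hkS
  simp only [sum_image hinj', hcard] at h
  refine h.trans ?_
  have h8 := log_eight_mul_ceil_log_le hN
  have h0 : 0 ≤ Real.log (8 * ⌈Real.log N⌉₊ : ℕ) := Real.log_natCast_nonneg _
  calc _ ≤ 2 * Real.exp 1 * Real.exp 10 * (2 * Real.exp 6 *
        ((1 + Real.log 16 / Real.log (Real.log 3)) * Real.log (Real.log N))) ^ 2 * N := by gcongr
    _ = _ := by ring
end
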